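/- Let m ≥ 1 be an integer and a_1,…,a_m > 0 real numbers, and define p : ℝ → ℝ by p(x) = (1+a_1x²)⋯(1+a_mx²) − 1. Then ∫_0^∞ p'(x) / ((p(x)+1)·√(p(x))) dx = π. -/

import Mathlib

open MeasureTheory Real

/-- For `m ≥ 1` and `a₁,…,a_m > 0`, with `p(x) = ∏ₖ(1 + aₖx²) - 1`, one has
`∫₀^∞ p'(x) / ((p(x)+1)√(p(x))) dx = π`, by the substitution `w = √(p(x))`. -/
theorem lawlor_angle_sum_integral
    (m : ℕ) (hm : 1 ≤ m) (a : Fin m → ℝ) (ha : ∀ i, 0 < a i)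
    (p : ℝ → ℝ) (hp : ∀ x : ℝ, p x = (∏ i, (1 + a i * x ^ 2)) - 1) :
    ∫ x in Set.Ioi (0:ℝ), deriv p x / ((p x + 1) * Real.sqrt (p x)) = π := by
  have hpe : p = fun x => (∏ i, (1 + a i * x ^ 2)) - 1 := funext hp
  have hd : Differentiable ℝ p := by
    rw [hpe]; fun_prop
  let i0 : Fin m := ⟨0, hm⟩
  have hlow : ∀ x, a i0 * x ^ 2 ≤ p x := by
    intro x
    rw [hp, ← Finset.mul_prod_erase Finset.univ _ (Finset.mem_univ i0)]
    have h1 : (1:ℝ) ≤ ∏ i ∈ Finset.univ.erase i0, (1 + a i * x ^ 2) := by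
      have := Finset.prod_le_prod (s := Finset.univ.erase i0) (f := fun _ => (1:ℝ))
        (g := fun i => 1 + a i * x ^ 2) (fun _ _ => zero_le_one)
        (fun i _ => by have := mul_nonneg (ha i).le (sq_nonneg x); linarith)
      simpa using this
    have h2 := mul_nonneg (ha i0).le (sq_nonneg x)
    nlinarith
  have hmono : MonotoneOn p (Set.Ici 0) := by
    intro x hx y hy hxy
    rw [hp, hp]
    have hx' : (0:ℝ) ≤ x := hx
    gcongr with i
    · intro i _
      have := mul_nonneg (ha i).le (sq_nonneg x)
      linarith
    · exact (ha i).le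
  have hdn : ∀ x ∈ Set.Ioi (0:ℝ), 0 ≤ deriv p x := by
    intro x hx
    have h := hmono.derivWithin_nonneg (x := x)
    rwa [derivWithin_of_mem_nhds (Ici_mem_nhds hx)] at h
  have hpos : ∀ x ∈ Set.Ioi (0:ℝ), 0 < p x := by
    intro x hx
    have hx' : (0:ℝ) < x := hx
    exact lt_of_lt_of_le (mul_pos (ha i0) (by positivity)) (hlow x)
  have htop : Filter.Tendsto p Filter.atTop Filter.atTop :=
    Filter.tendsto_atTop_mono hlow
      ((Filter.tendsto_pow_atTop two_ne_zero).const_mul_atTop (ha i0))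
  have key := integral_Ioi_of_hasDerivAt_of_nonneg (a := (0:ℝ)) (l := π)
    (g := fun x => 2 * Real.arctan (Real.sqrt (p x)))
    (g' := fun x => deriv p x / ((p x + 1) * Real.sqrt (p x))) ?_ ?_ ?_ ?_
  · rw [key]
    simp [hp]
  · have := hd.continuous
    exact Continuous.continuousWithinAt (by fun_prop)
  · intro x hx
    have h0 := hpos x hx
    have h := (((hd x).hasDerivAt.sqrt h0.ne').arctan).const_mul 2
    refine h.congr_deriv ?_
    rw [Real.sq_sqrt h0.le]
    have := Real.sqrt_pos.2 h0
    field_simp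
    ring
  · intro x hx
    have h0 := hpos x hx
    have := hdn x hx
    positivity
  · have h1 := (Real.tendsto_arctan_atTop.mono_right nhdsWithin_le_nhds).comp
      (Real.tendsto_sqrt_atTop.comp htop)
    have h2 := h1.const_mul 2
    rw [mul_div_cancel₀ π (two_ne_zero : (2:ℝ) ≠ 0)] at h2
    exact h2
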